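/- Let m ≥ 2 and let f(x₁,…,x_m) = u₁x₁ + ⋯ + u_mx_m be a linear form with nonzero integer coefficients satisfying gcd(u₁,…,u_m) = 1. Define N_f(k) = min{|f(A)| : A ⊆ ℤ, |A| = k}. Then N_f(k) = (|u₁| + ⋯ + |u_m|)·k − o(k); that is, lim_{k→∞} N_f(k)/k = |u₁| + ⋯ + |u_m|. -/

import Mathlib

open Filter

/-- The image of a finite set `A` of integers under the linear form
`f(x₁,…,x_m) = u₁x₁ + ⋯ + u_mx_m`. -/
def formImage {m : ℕ} (u : Fin m → ℤ) (A : Finset ℤ) : Finset ℤ :=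
  (Fintype.piFinset (fun _ : Fin m => A)).image (fun t => ∑ i, u i * t i)

section Helpers
open Finset Pointwise

/-- trivial lower bound for sumsets -/
lemma sum_card_le {ι : Type*} [DecidableEq ι] (s : Finset ι) (X : ι → Finset ℤ) (h : ∀ i, (X i).Nonempty) :
    (∑ i ∈ s, X i).Nonempty ∧ ∑ i ∈ s, (X i).card ≤ (∑ i ∈ s, X i).card + s.card := by
  induction s using Finset.induction_on with
  | empty => simp
  | insert a s ha ih =>
    rw [Finset.sum_insert ha, Finset.sum_insert ha, Finset.card_insert_of_notMem ha]
    refine ⟨(h a).add ih.1, ?_⟩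
    have := cauchy_davenport_add_of_linearOrder_isCancelAdd (h a) ih.1
    omega

def gsum {m : ℕ} (u : Fin m → ℤ) (B : Fin m → Finset ℤ) : Finset ℤ :=
  (Fintype.piFinset B).image (fun t => ∑ i, u i * t i)

lemma mem_gsum {m : ℕ} {u : Fin m → ℤ} {B : Fin m → Finset ℤ} {y : ℤ} :
    y ∈ gsum u B ↔ ∃ t : Fin m → ℤ, (∀ i, t i ∈ B i) ∧ ∑ i, u i * t i = y := by
  simp [gsum]

lemma gsum_eq {m : ℕ} (u : Fin m → ℤ) (B : Fin m → Finset ℤ) :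
    (∑ i, (B i).image (fun x => u i * x)) = gsum u B := by
  ext y
  rw [mem_gsum, ← Finset.mem_coe, Finset.coe_sum, Set.mem_fintype_sum]
  constructor
  · rintro ⟨g, hg, rfl⟩
    have : ∀ i, ∃ x ∈ B i, u i * x = g i := fun i => by simpa using hg i
    choose t ht h2 using this
    exact ⟨t, ht, by simp [h2]⟩
  · rintro ⟨t, ht, rfl⟩
    exact ⟨fun i => u i * t i, fun i => by simpa using ⟨t i, ht i, Or.inl rfl⟩, rfl⟩

lemma gsum_card {m : ℕ} (u : Fin m → ℤ) (hu : ∀ i, u i ≠ 0) (B : Fin m → Finset ℤ)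
    (h : ∀ i, (B i).Nonempty) : ∑ i, (B i).card ≤ (gsum u B).card + m := by
  have := (sum_card_le univ (fun i => (B i).image (fun x => u i * x)) (fun i => (h i).image _)).2
  rw [gsum_eq] at this
  simp only [Finset.card_univ, Fintype.card_fin] at this
  refine le_trans (le_of_eq ?_) this
  refine Finset.sum_congr rfl fun i _ => ?_
  rw [Finset.card_image_of_injective]
  exact mul_right_injective₀ (hu i)

/-- uniform fibres of surjective homs -/
lemma unif {G H : Type*} [AddCommGroup G] [AddCommGroup H] [Fintype G] [Fintype H] [DecidableEq H]
    (φ : G →+ H) (hφ : Function.Surjective φ) (P : H → Prop) [DecidablePred P] :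
    Fintype.card H * (univ.filter fun g => P (φ g)).card
      = Fintype.card G * (univ.filter fun h => P h).card := by
  classical
  have fib : ∀ h : H, (univ.filter fun g => φ g = h).card = (univ.filter fun g => φ g = 0).card := by
    intro h
    obtain ⟨g0, rfl⟩ := hφ h
    refine Finset.card_bij' (fun g _ => g - g0) (fun g _ => g + g0) ?_ ?_ ?_ ?_ <;> simp [sub_eq_zero]
  have key : ∀ (P : H → Prop) [DecidablePred P], (univ.filter fun g => P (φ g)).card
      = (univ.filter fun h => P h).card * (univ.filter fun g => φ g = 0).card := by
    intro P _
    rw [Finset.card_eq_sum_card_fiberwise (f := φ) (t := univ.filter fun h => P h)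
      (fun g hg => by simpa using hg)]
    rw [Finset.sum_const_nat (m := (univ.filter fun g => φ g = 0).card)]
    intro h hh
    rw [← fib h]
    congr 1
    ext g
    simp only [Finset.mem_filter, Finset.mem_univ, true_and] at hh ⊢
    exact ⟨fun h => h.2, fun h => ⟨h ▸ hh, h⟩⟩
  have h1 := key (fun _ => True)
  simp only [Finset.filter_true, Finset.card_univ] at h1
  rw [key P, h1]; ring

lemma fib_lower (Q : ℕ) [NeZero Q] (a : ℤ) (ha : a.natAbs ∣ Q) (b : ZMod Q) :
    a.natAbs ≤ (univ.filter fun j : ZMod Q => (a : ZMod Q) * j = a * b).card := by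
  obtain ⟨q, hq⟩ := ha
  have hQ : 0 < Q := Nat.pos_of_ne_zero (NeZero.ne Q)
  have hq0 : 0 < q := by
    rcases Nat.eq_zero_or_pos q with h | h
    · subst h; omega
    · exact h
  have hz : (a : ZMod Q) * (q : ZMod Q) = 0 := by
    have : ((a * q : ℤ) : ZMod Q) = 0 := by
      rw [ZMod.intCast_zmod_eq_zero_iff_dvd] 
      rw [hq]; push_cast
      exact mul_dvd_mul (by simp) dvd_rfl
    exact_mod_cast this
  calc a.natAbs = (Finset.range a.natAbs).card := by simp
    _ ≤ _ := by
      refine Finset.card_le_card_of_injOn (fun c => b + (c : ZMod Q) * q) ?_ ?_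
      · intro c _
        simp only [Finset.coe_filter, Finset.mem_univ, true_and, Set.mem_ofPred_eq]
        linear_combination (c : ZMod Q) * hz
      · intro c hc d hd h
        simp only [Finset.coe_range, Set.mem_Iio] at hc hd
        have h2 : ((c * q : ℕ) : ZMod Q) = ((d * q : ℕ) : ZMod Q) := by
          push_cast; exact add_left_cancel h
        rw [ZMod.natCast_eq_natCast_iff'] at h2
        rw [Nat.mod_eq_of_lt (by rw [hq]; exact Nat.mul_lt_mul_of_pos_right hc hq0),
          Nat.mod_eq_of_lt (by rw [hq]; exact Nat.mul_lt_mul_of_pos_right hd hq0)] at h2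
        exact Nat.eq_of_mul_eq_mul_right hq0 h2

lemma bezout {m : ℕ} (u : Fin m → ℤ) (hg : Finset.univ.gcd u = 1) : ∃ c : Fin m → ℤ, ∑ i, u i * c i = 1 := by
  obtain ⟨c, hc⟩ := Finset.gcd_eq_sum_mul univ u
  exact ⟨c, by rw [← hc, hg]⟩

/-- Fully distributed sets have large sums of dilates. -/
lemma full_case {m : ℕ} (u : Fin m → ℤ) (hu : ∀ i, u i ≠ 0) (hg : Finset.univ.gcd u = 1)
    (Q : ℕ) [NeZero Q] (hQ : ∀ i, (u i).natAbs ∣ Q) (B : Fin m → Finset ℤ)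
    (hB : ∀ i, ∀ c : ZMod Q, ∃ b ∈ B i, (b : ZMod Q) = c) :
    ∑ i, (u i).natAbs * (B i).card ≤ (gsum u B).card + Q * m := by
  classical
  let φ : (Fin m → ZMod Q) →+ ZMod Q :=
    { toFun := fun J => ∑ i, (u i : ZMod Q) * J i
      map_zero' := by simp
      map_add' := by intro x y; simp [mul_add, Finset.sum_add_distrib] }
  have hφ : Function.Surjective φ := by
    obtain ⟨c, hc⟩ := bezout u hg
    intro y
    refine ⟨fun i => (c i : ZMod Q) * y, ?_⟩
    change ∑ i, (u i : ZMod Q) * ((c i : ZMod Q) * y) = y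
    have : ((∑ i, u i * c i : ℤ) : ZMod Q) = 1 := by rw [hc]; simp
    push_cast at this
    simp_rw [← mul_assoc]
    rw [← Finset.sum_mul, this, one_mul]
  let C : Fin m → ZMod Q → Finset ℤ := fun i j =>
    (B i).filter fun b => (u i : ZMod Q) * j = u i * (b : ZMod Q)
  have h1 : ∀ J : Fin m → ZMod Q, ∑ i, (C i (J i)).card ≤
      ((gsum u B).filter fun y : ℤ => φ J = (y : ZMod Q)).card + m := by
    intro J
    refine le_trans (gsum_card u hu (fun i => C i (J i)) ?_) ?_
    · intro i
      obtain ⟨b, hb, hc⟩ := hB i (J i)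
      exact ⟨b, by simp [C, hb, hc]⟩
    · gcongr
      intro y hy
      obtain ⟨t, ht, rfl⟩ := mem_gsum.1 hy
      simp only [C, Finset.mem_filter] at ht ⊢
      refine ⟨mem_gsum.2 ⟨t, fun i => (ht i).1, rfl⟩, ?_⟩
      change ∑ i, (u i : ZMod Q) * J i = _
      push_cast
      exact Finset.sum_congr rfl fun i _ => (ht i).2
  have h2 := Finset.sum_le_sum (s := univ) fun J _ => h1 J
  rw [Finset.sum_add_distrib, Finset.sum_comm] at h2
  simp only [Finset.sum_const, Finset.card_univ, Fintype.card_pi, ZMod.card, Finset.prod_const,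
    Fintype.card_fin, smul_eq_mul] at h2
  have h3 : Q * ∑ J : Fin m → ZMod Q, ((gsum u B).filter fun y : ℤ => φ J = (y : ZMod Q)).card
      = Q ^ m * (gsum u B).card := by
    simp_rw [Finset.card_filter]
    rw [Finset.sum_comm]
    simp_rw [← Finset.card_filter]
    rw [Finset.mul_sum]
    have : ∀ y ∈ gsum u B, Q * (univ.filter fun J => φ J = (y : ZMod Q)).card = Q ^ m := by
      intro y _
      have := unif φ hφ (fun h => h = (y : ZMod Q))
      simpa [ZMod.card, Finset.filter_eq'] using this
    rw [Finset.sum_congr rfl this]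
    simp [mul_comm]
  have h4 : ∀ i, Q ^ m * ((u i).natAbs * (B i).card) ≤
      Q * ∑ J : Fin m → ZMod Q, (C i (J i)).card := by
    intro i
    simp_rw [C, Finset.card_filter]
    rw [Finset.sum_comm]
    simp_rw [← Finset.card_filter]
    rw [Finset.mul_sum]
    have : ∀ b ∈ B i, Q ^ m * (u i).natAbs ≤
        Q * (univ.filter fun J : Fin m → ZMod Q => (u i : ZMod Q) * J i = u i * (b : ZMod Q)).card := by
      intro b _
      have := unif (Pi.evalAddMonoidHom (fun _ : Fin m => ZMod Q) i)
        (Function.surjective_eval i) (fun j => (u i : ZMod Q) * j = u i * (b : ZMod Q))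
      simp only [ZMod.card, Fintype.card_pi, Finset.prod_const, Finset.card_univ,
        Fintype.card_fin, Pi.evalAddMonoidHom_apply] at this
      rw [this]
      exact Nat.mul_le_mul_left _ (fib_lower Q (u i) (hQ i) b)
    calc _ = ∑ b ∈ B i, Q ^ m * (u i).natAbs := by simp; ring
      _ ≤ _ := Finset.sum_le_sum this
  have h5 := Finset.sum_le_sum (s := univ) fun i _ => h4 i
  rw [← Finset.mul_sum, ← Finset.mul_sum] at h5
  have hpos : 0 < Q ^ m := pow_pos (Nat.pos_of_ne_zero (NeZero.ne Q)) m
  refine Nat.le_of_mul_le_mul_left ?_ hpos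
  calc _ ≤ _ := h5
    _ ≤ _ := Nat.mul_le_mul_left Q h2
    _ = Q ^ m * (gsum u B).card + Q * (Q ^ m * m) := by rw [mul_add, h3]
    _ = _ := by ring

/-- factorization of moduli -/
lemma factor {m : ℕ} (u : Fin m → ℤ) (hg : Finset.univ.gcd u = 1) (n : ℕ) (hn : n ≠ 0) :
    ∃ ν : Fin m → ℕ, ∏ i, ν i = n ∧ ∀ i, IsCoprime (u i) (ν i : ℤ) := by
  classical
  induction n using Nat.recOnMul with
  | zero => exact absurd rfl hn
  | one => exact ⟨fun _ => 1, by simp, fun i => by simpa using isCoprime_one_right⟩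
  | prime p hp =>
    have : ∃ i, ¬ (p : ℤ) ∣ u i := by
      by_contra! h
      have h2 : (p : ℤ) ∣ Finset.univ.gcd u := Finset.dvd_gcd fun i _ => h i
      rw [hg] at h2
      exact hp.one_lt.ne' (by simpa using Int.natAbs_dvd_natAbs.2 h2)
    obtain ⟨i, hi⟩ := this
    refine ⟨Function.update (fun _ => 1) i p, ?_, ?_⟩
    · rw [Finset.prod_update_of_mem (Finset.mem_univ i)]; simp
    · intro j
      by_cases h : j = i
      · subst h
        simp only [Function.update_self]
        exact ((Nat.prime_iff_prime_int.1 hp).coprime_iff_not_dvd.2 hi).symm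
      · simpa [Function.update_of_ne h] using isCoprime_one_right
  | mul a b iha ihb =>
    obtain ⟨ν, h1, h2⟩ := iha (by rintro rfl; simp at hn)
    obtain ⟨μ, h3, h4⟩ := ihb (by rintro rfl; simp at hn)
    refine ⟨fun i => ν i * μ i, by rw [Finset.prod_mul_distrib, h1, h3], fun i => ?_⟩
    push_cast
    exact (h2 i).mul_right (h4 i)

lemma emod_eq_of_dvd {n x y : ℤ} (h : n ∣ x - y) : x % n = y % n :=
  Int.ModEq.symm ((Int.modEq_iff_dvd).2 h)

/-- number of residue classes mod `n` hit by `A` -/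
def rc (A : Finset ℤ) (n : ℕ) : ℕ := (A.image (fun a => a % (n : ℤ))).card

lemma rc_mono {A B : Finset ℤ} (h : A ⊆ B) (n : ℕ) : rc A n ≤ rc B n :=
  Finset.card_le_card (Finset.image_subset_image h)

lemma claimC_aux (l : ℕ) : ∀ (u : Fin l → ℤ) (ν : Fin l → ℕ) (_ : ∀ i, IsCoprime (u i) (ν i : ℤ))
    (M : ℕ) (_ : M ≠ 0) (_ : ∀ i, ν i ≠ 0)
    (R : Finset ℤ) (_ : ∀ x ∈ R, ∀ y ∈ R, (M : ℤ) ∣ x - y),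
    rc R (M * ∏ i, ν i) ≤ rc (gsum u fun _ => R) (M * ∏ i, ν i) := by
  classical
  induction l with
  | zero =>
    intro u ν _ M _ _ R hR
    have h1 : rc R (M * ∏ i, ν i) ≤ 1 := by
      unfold rc
      rw [Finset.card_le_one]
      intro a ha b hb
      simp only [Finset.mem_image] at ha hb
      obtain ⟨x, hx, rfl⟩ := ha
      obtain ⟨y, hy, rfl⟩ := hb
      exact emod_eq_of_dvd (by simpa using hR x hx y hy)
    refine h1.trans ?_
    unfold rc
    rw [Nat.one_le_iff_ne_zero, Finset.card_ne_zero]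
    exact ⟨_, Finset.mem_image_of_mem _ (mem_gsum.2 ⟨fun _ => 0, fun i => i.elim0, rfl⟩)⟩
  | succ l ih =>
    intro u ν hco M hM hν R hR
    rcases R.eq_empty_or_nonempty with rfl | hne
    · simp [rc]
    set N : ℕ := M * ∏ i, ν i with hN
    set n₀ := M * ν 0 with hn₀
    have hNn : N = n₀ * ∏ i : Fin l, ν i.succ := by
      rw [hN, Fin.prod_univ_succ, hn₀]; ring
    have hdvd : (n₀ : ℤ) ∣ N := by rw [hNn]; push_cast; exact dvd_mul_right _ _
    -- classes mod n₀
    set I := R.image (fun a => a % (n₀ : ℤ)) with hI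
    have hIne : I.Nonempty := hne.image _
    let F : ℤ → Finset ℤ := fun c => R.filter fun a => a % (n₀ : ℤ) = c
    obtain ⟨c, hcI, hc⟩ := Finset.exists_max_image I (fun c => rc (F c) N) hIne
    have hF : ∀ x ∈ F c, ∀ y ∈ F c, (n₀ : ℤ) ∣ x - y := by
      intro x hx y hy
      simp only [F, Finset.mem_filter] at hx hy
      exact Int.ModEq.dvd (n := n₀) (by rw [Int.ModEq, hx.2, hy.2])
    have hih := ih (fun i => u i.succ) (fun i => ν i.succ) (fun i => hco _) n₀
      (mul_ne_zero hM (hν 0)) (fun i => hν _) (F c) hF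
    rw [← hNn] at hih
    have hle : rc R N ≤ I.card * rc (F c) N := by
      have : R.image (fun a => a % (N : ℤ)) ⊆ I.biUnion fun c => (F c).image fun a => a % (N : ℤ) := by
        intro z hz
        simp only [Finset.mem_image] at hz
        obtain ⟨a, ha, rfl⟩ := hz
        simp only [Finset.mem_biUnion]
        exact ⟨a % n₀, Finset.mem_image_of_mem _ ha, Finset.mem_image_of_mem _ (by simp [F, ha])⟩
      exact (Finset.card_le_card this).trans (Finset.card_biUnion_le_card_mul _ _ _ hc)
    refine hle.trans ((Nat.mul_le_mul_left _ hih).trans ?_)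
    unfold rc
    rw [← Finset.card_product]
    have hrep : ∀ z ∈ I, ∃ ρ ∈ R, ρ % (n₀ : ℤ) = z := fun z hz => by simpa [I] using hz
    choose! ρ hρ hρ2 using hrep
    have hyrep : ∀ z ∈ (gsum (fun i => u i.succ) fun _ => F c).image (fun a => a % (N : ℤ)),
        ∃ y ∈ (gsum (fun i => u i.succ) fun _ => F c), y % (N : ℤ) = z := fun z hz => by simpa using hz
    choose! y hy hy2 using hyrep
    refine Finset.card_le_card_of_injOn (fun p => (u 0 * ρ p.1 + y p.2) % (N : ℤ)) ?_ ?_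
    · rintro ⟨a, b⟩ hab
      simp only [Finset.coe_product, Set.mem_prod, Finset.mem_coe] at hab
      obtain ⟨t, ht, hts⟩ := mem_gsum.1 (hy b hab.2)
      refine Finset.mem_coe.2 (Finset.mem_image_of_mem _ (mem_gsum.2 ⟨Fin.cons (ρ a) t, ?_, ?_⟩))
      · intro i
        refine Fin.cases ?_ (fun j => ?_) i
        · simpa using hρ a hab.1
        · have := ht j
          simp only [F, Finset.mem_filter] at this
          simpa using this.1
      · rw [Fin.sum_univ_succ]
        simp [← hts]
    · rintro ⟨a, b⟩ hab ⟨a', b'⟩ hab' h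
      simp only [Finset.coe_product, Set.mem_prod, Finset.mem_coe] at hab hab'
      simp only at h
      have hd : (N : ℤ) ∣ (u 0 * ρ a + y b) - (u 0 * ρ a' + y b') := Int.ModEq.dvd (n := N) h.symm
      have hyy : (n₀ : ℤ) ∣ y b - y b' := by
        obtain ⟨t, ht, hts⟩ := mem_gsum.1 (hy b hab.2)
        obtain ⟨t', ht', hts'⟩ := mem_gsum.1 (hy b' hab'.2)
        rw [← hts, ← hts', ← Finset.sum_sub_distrib]
        refine Finset.dvd_sum fun i _ => ?_
        rw [← mul_sub]
        exact Dvd.dvd.mul_left (hF _ (ht i) _ (ht' i)) _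
      have hd2 : (n₀ : ℤ) ∣ u 0 * (ρ a - ρ a') := by
        have := dvd_sub (hdvd.trans hd) hyy
        rwa [show (u 0 * ρ a + y b) - (u 0 * ρ a' + y b') - (y b - y b') = u 0 * (ρ a - ρ a') by ring] at this
      obtain ⟨z, hz⟩ := hR _ (hρ a hab.1) _ (hρ a' hab'.1)
      have hd3 : (n₀ : ℤ) ∣ ρ a - ρ a' := by
        rw [hz] at hd2 ⊢
        rw [hn₀] at hd2 ⊢
        push_cast at hd2 ⊢
        have : (M : ℤ) * ν 0 ∣ M * (u 0 * z) := by
          rwa [show (M : ℤ) * (u 0 * z) = u 0 * (M * z) by ring]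
        have := Int.dvd_of_mul_dvd_mul_left (by exact_mod_cast hM) this
        exact mul_dvd_mul_left _ ((hco 0).symm.dvd_of_dvd_mul_left this)
      have haa : a = a' := by
        rw [← hρ2 a hab.1, ← hρ2 a' hab'.1]
        exact emod_eq_of_dvd hd3
      subst haa
      have hbb : b = b' := by
        rw [← hy2 b hab.2, ← hy2 b' hab'.2]
        have : (N : ℤ) ∣ y b - y b' := by
          rwa [add_sub_add_left_eq_sub] at hd
        exact emod_eq_of_dvd this
      rw [hbb]

lemma claimC {m : ℕ} (u : Fin m → ℤ) (hg : Finset.univ.gcd u = 1) (n : ℕ) (hn : n ≠ 0)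
    (R : Finset ℤ) : rc R n ≤ rc (gsum u fun _ => R) n := by
  obtain ⟨ν, h1, h2⟩ := factor u hg n hn
  have := claimC_aux m u ν h2 1 one_ne_zero
    (fun i hi => hn (by rw [← h1]; exact Finset.prod_eq_zero (Finset.mem_univ i) hi)) R (by simp)
  rwa [one_mul, h1] at this

lemma count_full {m : ℕ} (u : Fin m → ℤ) (hu : ∀ i, u i ≠ 0) (hg : Finset.univ.gcd u = 1)
    (Q : ℕ) [NeZero Q] (hQ : ∀ i, (u i).natAbs ∣ Q) (n : ℕ) (hn : n ≠ 0) (A : Finset ℤ)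
    (hA : ∀ a ∈ A, ∀ c : ZMod Q, ∃ z : ℤ, a + n * z ∈ A ∧ (z : ZMod Q) = c) :
    (∑ i, (u i).natAbs) * A.card ≤ (gsum u fun _ => A).card + rc A n * (Q * m) := by
  classical
  set S := ∑ i, (u i).natAbs with hS
  set R := A.image (fun a => a % (n : ℤ)) with hR
  have hnz : (n : ℤ) ≠ 0 := by exact_mod_cast hn
  have hRmod : ∀ x ∈ R, x % (n : ℤ) = x := by
    intro x hx
    obtain ⟨a, _, rfl⟩ := Finset.mem_image.1 hx
    exact Int.emod_emod_of_dvd _ dvd_rfl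
  let cl : ℤ → Finset ℤ := fun x => A.filter fun a => a % (n : ℤ) = x
  let w : ℤ → ℕ := fun x => (cl x).card
  let Rt : ℕ → Finset ℤ := fun t => R.filter fun y => t ≤ w y
  let T : R → Finset ℤ := fun x => (gsum u fun _ => Rt (w x)).image (fun a => a % (n : ℤ))
  have hall : ∀ Y : Finset R, Y.card ≤ (Y.biUnion T).card := by
    intro Y
    rcases Y.eq_empty_or_nonempty with rfl | hne
    · simp
    obtain ⟨x, hx, hmin⟩ := Finset.exists_min_image Y (fun x => w x) hne
    calc Y.card = (Y.image Subtype.val).card := (Finset.card_image_of_injective _ Subtype.val_injective).symm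
      _ ≤ (Rt (w x)).card := by
        apply Finset.card_le_card
        intro y hy
        obtain ⟨y', hy', rfl⟩ := Finset.mem_image.1 hy
        exact Finset.mem_filter.2 ⟨y'.2, hmin y' hy'⟩
      _ = rc (Rt (w x)) n := by
        unfold rc
        rw [Finset.card_image_of_injOn]
        intro a ha b hb h
        simp only at h
        rwa [hRmod a (Finset.mem_filter.1 ha).1, hRmod b (Finset.mem_filter.1 hb).1] at h
      _ ≤ (T x).card := claimC u hg n hn _
      _ ≤ _ := Finset.card_le_card (Finset.subset_biUnion_of_mem T hx)
  obtain ⟨φ, hinj, hφ⟩ := (Finset.all_card_le_biUnion_card_iff_exists_injective T).1 hall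
  have key : ∀ x : R, S * w x ≤
      ((gsum u fun _ => A).filter fun y => y % (n : ℤ) = φ x).card + Q * m := by
    intro x
    obtain ⟨s, hs, hsx⟩ := Finset.mem_image.1 (hφ x)
    obtain ⟨t, ht, hts⟩ := mem_gsum.1 hs
    have ht1 : ∀ i, t i ∈ R := fun i => (Finset.mem_filter.1 (ht i)).1
    have ht2 : ∀ i, w x ≤ w (t i) := fun i => (Finset.mem_filter.1 (ht i)).2
    let B : Fin m → Finset ℤ := fun i => (cl (t i)).image fun a => a / (n : ℤ)
    have hcl : ∀ i, ∀ a ∈ cl (t i), a = t i + n * (a / n) := by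
      intro i a ha
      have := Int.emod_add_mul_ediv a n
      rw [(Finset.mem_filter.1 ha).2] at this
      exact this.symm
    have hBc : ∀ i, (B i).card = w (t i) := by
      intro i
      apply Finset.card_image_of_injOn
      intro a ha b hb h
      rw [hcl i a ha, hcl i b hb]
      simp only at h
      rw [h]
    have hBmem : ∀ i, ∀ z ∈ B i, t i + n * z ∈ A := by
      intro i z hz
      obtain ⟨a, ha, rfl⟩ := Finset.mem_image.1 hz
      rw [← hcl i a ha]
      exact (Finset.mem_filter.1 ha).1
    have hfull : ∀ i, ∀ c : ZMod Q, ∃ b ∈ B i, (b : ZMod Q) = c := by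
      intro i c
      obtain ⟨a, ha, hai⟩ := Finset.mem_image.1 (ht1 i)
      have hacl : a ∈ cl (t i) := Finset.mem_filter.2 ⟨ha, hai⟩
      obtain ⟨z, hz, hzc⟩ := hA a ha (c - (a / n : ℤ))
      refine ⟨a / n + z, Finset.mem_image.2 ⟨a + n * z, Finset.mem_filter.2 ⟨hz, ?_⟩, ?_⟩, ?_⟩
      · rw [Int.add_mul_emod_self_left]; exact hai
      · rw [Int.add_mul_ediv_left _ _ hnz]
      · push_cast; rw [hzc]; ring
    have h1 := full_case u hu hg Q hQ B hfull
    have h2 : S * w x ≤ ∑ i, (u i).natAbs * (B i).card := by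
      rw [hS, Finset.sum_mul]
      refine Finset.sum_le_sum fun i _ => ?_
      rw [hBc]
      exact Nat.mul_le_mul_left _ (ht2 i)
    refine h2.trans (h1.trans ?_)
    refine Nat.add_le_add_right ?_ _
    refine Finset.card_le_card_of_injOn (fun y => s + n * y) ?_ ?_
    · intro y hy
      obtain ⟨v, hv, hvy⟩ := mem_gsum.1 hy
      refine Finset.mem_coe.2 (Finset.mem_filter.2 ⟨mem_gsum.2 ⟨fun i => t i + n * v i, fun i => hBmem i _ (hv i), ?_⟩, ?_⟩)
      · change ∑ i, u i * (t i + n * v i) = s + n * y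
        rw [← hts, ← hvy, Finset.mul_sum, ← Finset.sum_add_distrib]
        exact Finset.sum_congr rfl fun i _ => by ring
      · rw [Int.add_mul_emod_self_left]; exact hsx
    · intro a _ b _ h
      simp only [add_right_inj] at h
      exact mul_left_cancel₀ hnz h
  have hsum := Finset.sum_le_sum (s := univ) fun x _ => key x
  rw [Finset.sum_add_distrib, ← Finset.mul_sum] at hsum
  have e1 : ∑ x : R, w x = A.card := by
    rw [Finset.sum_coe_sort R w]
    exact (Finset.card_eq_sum_card_image _ A).symm
  have e2 : ∑ x : R, ((gsum u fun _ => A).filter fun y => y % (n : ℤ) = φ x).card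
      ≤ (gsum u fun _ => A).card := by
    rw [← Finset.card_biUnion]
    · apply Finset.card_le_card
      intro y hy
      simp only [Finset.mem_biUnion, Finset.mem_filter] at hy
      obtain ⟨_, _, h, _⟩ := hy
      exact h
    · intro x _ y _ hxy
      refine Finset.disjoint_left.2 ?_
      intro z hz hz'
      exact hxy (hinj ((Finset.mem_filter.1 hz).2.symm.trans (Finset.mem_filter.1 hz').2))
  rw [e1] at hsum
  refine hsum.trans (Nat.add_le_add e2 ?_)
  simp [rc, hR]

lemma nsmul_repr (F : Finset ℤ) (j : ℕ) : ∀ x ∈ j • F, ∃ g : ℤ → ℕ, (∀ a, g a ≤ j) ∧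
    ∑ a ∈ F, (g a : ℤ) * a = x := by
  induction j with
  | zero =>
    intro x hx
    rw [zero_nsmul, Finset.mem_zero] at hx
    exact ⟨fun _ => 0, by simp, by simp [hx]⟩
  | succ j ih =>
    intro x hx
    rw [succ_nsmul, Finset.mem_add] at hx
    obtain ⟨y, hy, b, hb, rfl⟩ := hx
    obtain ⟨g, hg, hgy⟩ := ih y hy
    refine ⟨fun a => g a + if a = b then 1 else 0, fun a => ?_, ?_⟩
    · have := hg a
      dsimp only
      split_ifs <;> omega
    · rw [← hgy]
      push_cast
      simp only [add_mul, Finset.sum_add_distrib]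
      simp [hb]

lemma card_nsmul_poly (F : Finset ℤ) (j : ℕ) : (j • F).card ≤ (j + 1) ^ F.card := by
  classical
  have : j • F ⊆ (Fintype.piFinset fun _ : F => Finset.range (j + 1)).image
      (fun g => ∑ a : F, (g a : ℤ) * (a : ℤ)) := by
    intro x hx
    obtain ⟨g, hg, rfl⟩ := nsmul_repr F j x hx
    refine Finset.mem_image.2 ⟨fun a => g a, ?_, ?_⟩
    · rw [Fintype.mem_piFinset]
      intro a
      rw [Finset.mem_range]
      exact Nat.lt_succ_of_le (hg a)
    · exact Finset.sum_coe_sort F (fun a => (g a : ℤ) * a)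
  refine (Finset.card_le_card this).trans (Finset.card_image_le.trans ?_)
  simp

lemma growth (K : ℕ) (A : Finset ℤ) (hne : A.Nonempty) (hA : (A - A).card ≤ K * A.card) (j : ℕ) :
    ((j + 1) • (A - A)).card ≤ (j + 1) ^ (K ^ 5) * (K * A.card) := by
  have hpos : (0 : ℚ≥0) < A.card := by exact_mod_cast hne.card_pos
  have hpr := Finset.pluennecke_ruzsa_inequality_nsmul_sub_nsmul_sub hne A 3 2
  have hKq : ((A - A).card / A.card : ℚ≥0) ≤ K := by
    rw [div_le_iff₀ hpos]; exact_mod_cast hA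
  have h1 : ((3 • A - 2 • A).card : ℚ≥0) ≤ (K : ℚ≥0) ^ 5 * A.card :=
    hpr.trans (by gcongr)
  have h1' : (3 • A - 2 • A).card ≤ K ^ 5 * A.card := by exact_mod_cast h1
  have heq : (A - A) + (A - A) + A = 3 • A - 2 • A := by
    rw [sub_add_sub_comm, sub_add_eq_add_sub, succ_nsmul, two_nsmul]
  rw [← heq] at h1'
  obtain ⟨F, _, hF, hcov⟩ := Finset.ruzsa_covering_add (A := (A - A) + (A - A)) (K := ((K ^ 5 : ℕ) : ℝ)) hne
    (by exact_mod_cast h1')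
  have hF' : F.card ≤ K ^ 5 := by exact_mod_cast hF
  have hsub : ∀ j : ℕ, (j + 1) • (A - A) ⊆ j • F + (A - A) := by
    intro j
    induction j with
    | zero => simp
    | succ j ih =>
      calc (j + 1 + 1) • (A - A) = (j + 1) • (A - A) + (A - A) := succ_nsmul _ _
        _ ⊆ j • F + (A - A) + (A - A) := Finset.add_subset_add_right ih
        _ = j • F + ((A - A) + (A - A)) := add_assoc _ _ _
        _ ⊆ j • F + (F + (A - A)) := Finset.add_subset_add_left hcov
        _ = _ := by rw [← add_assoc, succ_nsmul]
  calc _ ≤ _ := Finset.card_le_card (hsub j)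
    _ ≤ (j • F).card * (A - A).card := Finset.card_add_le
    _ ≤ _ := Nat.mul_le_mul ((card_nsmul_poly F j).trans (Nat.pow_le_pow_right (Nat.succ_pos j) hF')) hA

lemma reach (Q : ℕ) [NeZero Q] (D : Finset ℤ) (h0 : (0 : ℤ) ∈ D) (g : ℤ) (hg0 : g ≠ 0)
    (hg : D.gcd id = g) (c : ZMod Q) : ∃ e' : ℤ, g * e' ∈ (Q * Q) • D ∧ (e' : ZMod Q) = c := by
  classical
  obtain ⟨a, ha⟩ := Finset.gcd_eq_sum_mul D id
  have hd : ∀ d ∈ D, g * (d / g) = d := fun d hd =>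
    Int.mul_ediv_cancel' (hg ▸ Finset.gcd_dvd (f := id) hd)
  have h1 : ∑ d ∈ D, (d / g) * a d = 1 := by
    apply mul_left_cancel₀ hg0
    rw [Finset.mul_sum, mul_one]
    conv_rhs => rw [← hg, ha]
    refine Finset.sum_congr rfl fun d hd' => ?_
    rw [← mul_assoc, hd d hd', id]
  let G : ZMod Q → ZMod Q := fun t => ∑ d ∈ D with ((d / g : ℤ) : ZMod Q) = t, (a d : ZMod Q)
  have h2 : ∑ t : ZMod Q, t * G t = 1 := by
    have : ((∑ d ∈ D, (d / g) * a d : ℤ) : ZMod Q) = 1 := by rw [h1]; simp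
    push_cast at this
    rw [← this, ← Finset.sum_fiberwise D (fun d => ((d / g : ℤ) : ZMod Q))]
    refine Finset.sum_congr rfl fun t _ => ?_
    simp only [G, Finset.mul_sum]
    refine Finset.sum_congr rfl fun d hd' => ?_
    rw [(Finset.mem_filter.1 hd').2]
  have hrep : ∀ t : ZMod Q, ∃ d ∈ D, G t ≠ 0 → ((d / g : ℤ) : ZMod Q) = t := by
    intro t
    by_cases h : G t = 0
    · exact ⟨0, h0, fun h' => absurd h h'⟩
    · obtain ⟨d, hd', _⟩ := Finset.exists_ne_zero_of_sum_ne_zero h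
      exact ⟨d, (Finset.mem_filter.1 hd').1, fun _ => (Finset.mem_filter.1 hd').2⟩
  choose ρ hρ hρ2 using hrep
  refine ⟨∑ t : ZMod Q, ((c * G t).val : ℤ) * (ρ t / g), ?_, ?_⟩
  · rw [Finset.mul_sum]
    have hm : ∀ t : ZMod Q, g * (((c * G t).val : ℤ) * (ρ t / g)) ∈ Q • D := by
      intro t
      rw [mul_left_comm, hd _ (hρ t), ← nsmul_eq_mul]
      exact Finset.nsmul_subset_nsmul_right h0 (ZMod.val_lt _).le
        (Finset.nsmul_mem_nsmul (hρ t))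
    have hs : ∀ s : Finset (ZMod Q), ∑ t ∈ s, g * (((c * G t).val : ℤ) * (ρ t / g)) ∈ s.card • (Q • D) := by
      intro s
      induction s using Finset.induction_on with
      | empty => simp
      | insert x s hx ih =>
        rw [Finset.sum_insert hx, Finset.card_insert_of_notMem hx, succ_nsmul, add_comm (g * _)]
        exact Finset.add_mem_add ih (hm x)
    have := hs univ
    rwa [Finset.card_univ, ZMod.card, ← mul_nsmul] at this
  · push_cast
    calc _ = ∑ t : ZMod Q, c * (t * G t) := by
          refine Finset.sum_congr rfl fun t _ => ?_
          rw [ZMod.natCast_val, ZMod.cast_id', id]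
          by_cases h : G t = 0
          · simp [h]
          · rw [hρ2 t h]; ring
      _ = c := by rw [← Finset.mul_sum, h2, mul_one]

lemma img_le {β γ : Type*} [DecidableEq β] [DecidableEq γ] (A : Finset ℤ) (f : ℤ → β) (g : ℤ → γ)
    (h : ∀ a ∈ A, ∀ b ∈ A, f a = f b → g a = g b) : (A.image g).card ≤ (A.image f).card := by
  have : ∀ z ∈ A.image g, ∃ a ∈ A, g a = z := fun z hz => by simpa using hz
  choose! ρ h1 h2 using this
  refine Finset.card_le_card_of_injOn (fun z => f (ρ z)) ?_ ?_
  · intro z hz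
    exact Finset.mem_coe.2 (Finset.mem_image_of_mem _ (h1 z hz))
  · intro z hz w hw hzw
    rw [← h2 z hz, ← h2 w hw]
    exact h _ (h1 z hz) _ (h1 w hw) hzw

lemma chain (Q : ℕ) [NeZero Q] (A : Finset ℤ) (θ : ℝ) (hθ0 : 0 ≤ θ) (hθ : θ ≤ Q) (L0 : ℕ)
    (hcard : Q ^ L0 < A.card)
    (H : ∀ n : ℕ, n ≠ 0 → rc A n ≤ Q ^ L0 → (rc A (n * Q) : ℝ) < θ * rc A n) :
    ∀ L ≤ L0, ∃ N : ℕ, N ≠ 0 ∧ ∃ E : Finset ℤ, E ⊆ (L * (Q * Q)) • (A - A) ∧ E.card = Q ^ L ∧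
      (∀ x ∈ E, ∀ y ∈ E, (N : ℤ) ∣ x - y → x = y) ∧ (rc A N : ℝ) ≤ θ ^ L := by
  classical
  have hQ0 : Q ≠ 0 := NeZero.ne Q
  have hne : A.Nonempty := Finset.card_pos.1 (by omega)
  have h0D : (0 : ℤ) ∈ A - A := by
    obtain ⟨a, ha⟩ := hne
    exact Finset.mem_sub.2 ⟨a, ha, a, ha, sub_self a⟩
  intro L
  induction L with
  | zero =>
    intro _
    refine ⟨1, one_ne_zero, {0}, by simp, by simp, by simp, ?_⟩
    have : rc A 1 ≤ 1 := by
      unfold rc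
      rw [Finset.card_le_one]
      simp
    simpa using this
  | succ L ih =>
    intro hL
    obtain ⟨N, hN, E, hE, hEc, hEinj, hr⟩ := ih (by omega)
    have hrQ : rc A N ≤ Q ^ L0 := by
      have h1 : (rc A N : ℝ) ≤ (Q : ℝ) ^ L := hr.trans (pow_le_pow_left₀ hθ0 hθ L)
      have h2 : rc A N ≤ Q ^ L := by exact_mod_cast h1
      exact h2.trans (Nat.pow_le_pow_right (Nat.pos_of_ne_zero hQ0) (by omega))
    obtain ⟨a, ha, b, hb, hab, hmod⟩ := Finset.exists_ne_map_eq_of_card_lt_of_maps_to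
      (lt_of_le_of_lt hrQ hcard) (f := fun a => a % (N : ℤ))
      (fun a ha => Finset.mem_coe.2 (Finset.mem_image_of_mem _ ha))
    set Dn := (A - A).filter fun d => (N : ℤ) ∣ d with hDn
    have h0 : (0 : ℤ) ∈ Dn := Finset.mem_filter.2 ⟨h0D, dvd_zero _⟩
    obtain ⟨g, hg⟩ : ∃ g : ℕ, (g : ℤ) = Dn.gcd id :=
      ⟨(Dn.gcd id).natAbs, Int.natAbs_of_nonneg (Int.nonneg_of_normalize_eq_self Finset.normalize_gcd)⟩
    have hdiff : ∀ x ∈ A, ∀ y ∈ A, (N : ℤ) ∣ x - y → (g : ℤ) ∣ x - y := by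
      intro x hx y hy h
      rw [hg]
      exact Finset.gcd_dvd (f := id) (Finset.mem_filter.2 ⟨Finset.sub_mem_sub hx hy, h⟩)
    have hg0 : (g : ℤ) ≠ 0 := by
      intro h
      have := hdiff a ha b hb (Int.ModEq.dvd (n := N) hmod.symm)
      rw [h, zero_dvd_iff, sub_eq_zero] at this
      exact hab this
    have hNg : (N : ℤ) ∣ g := by
      rw [hg]
      exact Finset.dvd_gcd fun d hd => (Finset.mem_filter.1 hd).2
    have hrg : rc A g ≤ rc A N := img_le A _ _ fun x hx y hy h =>
      emod_eq_of_dvd (hdiff x hx y hy (Int.ModEq.dvd (n := N) h.symm))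
    choose e he he2 using reach Q Dn h0 g hg0 hg.symm
    have hinj : ∀ p ∈ E ×ˢ (univ : Finset (ZMod Q)), ∀ p' ∈ E ×ˢ (univ : Finset (ZMod Q)),
        ((g * Q : ℕ) : ℤ) ∣ (p.1 + g * e p.2) - (p'.1 + g * e p'.2) → p = p' := by
      rintro ⟨x, c⟩ hp ⟨x', c'⟩ hp' h
      simp only [Finset.mem_product, Finset.mem_univ, and_true] at hp hp'
      simp only at h
      push_cast at h
      have hgx : (g : ℤ) ∣ x - x' := by
        have h1 : (g : ℤ) ∣ (x + g * e c) - (x' + g * e c') := (dvd_mul_right _ _).trans h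
        have h2 : (g : ℤ) ∣ g * (e c - e c') := dvd_mul_right _ _
        have h3 := dvd_sub h1 h2
        rwa [show (x + g * e c) - (x' + g * e c') - g * (e c - e c') = x - x' by ring] at h3
      have hxx : x = x' := hEinj x hp x' hp' (hNg.trans hgx)
      subst hxx
      have h4 : (g : ℤ) * Q ∣ g * (e c - e c') := by
        rwa [show (x + g * e c) - (x + g * e c') = g * (e c - e c') by ring] at h
      have h5 := Int.dvd_of_mul_dvd_mul_left hg0 h4
      have h6 : ((e c - e c' : ℤ) : ZMod Q) = 0 := (ZMod.intCast_zmod_eq_zero_iff_dvd _ _).2 h5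
      push_cast at h6
      rw [he2, he2, sub_eq_zero] at h6
      rw [h6]
    refine ⟨g * Q, mul_ne_zero (by exact_mod_cast hg0) hQ0,
      (E ×ˢ (univ : Finset (ZMod Q))).image (fun p => p.1 + g * e p.2), ?_, ?_, ?_, ?_⟩
    · intro y hy
      obtain ⟨⟨x, c⟩, hp, rfl⟩ := Finset.mem_image.1 hy
      rw [add_mul, one_mul, add_nsmul]
      refine Finset.add_mem_add (hE (Finset.mem_product.1 hp).1) ?_
      exact Finset.nsmul_subset_nsmul_left (Finset.filter_subset _ _) (he c)
    · rw [Finset.card_image_of_injOn, Finset.card_product, hEc, Finset.card_univ, ZMod.card, pow_succ]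
      intro p hp p' hp' h
      exact hinj p hp p' hp' (by simp only at h; rw [h, sub_self]; exact dvd_zero _)
    · intro y hy y' hy' h
      obtain ⟨p, hp, rfl⟩ := Finset.mem_image.1 hy
      obtain ⟨p', hp', rfl⟩ := Finset.mem_image.1 hy'
      rw [hinj p hp p' hp' h]
    · have h1 := H g (by exact_mod_cast hg0) (hrg.trans hrQ)
      have h2 : (rc A g : ℝ) ≤ θ ^ L := le_trans (by exact_mod_cast hrg) hr
      rw [pow_succ, mul_comm (θ ^ L)]
      exact h1.le.trans (mul_le_mul_of_nonneg_left h2 hθ0)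

lemma part1 (K Q : ℕ) [NeZero Q] (θ : ℝ) (hθ0 : 0 ≤ θ) (hθ : θ < Q) : ∃ B : ℕ, ∀ A : Finset ℤ,
    B < A.card → (A - A).card ≤ K * A.card →
      ∃ n : ℕ, n ≠ 0 ∧ rc A n ≤ B ∧ θ * rc A n ≤ rc A (n * Q) := by
  classical
  have hQ0 : (0 : ℝ) < Q := by exact_mod_cast Nat.pos_of_ne_zero (NeZero.ne Q)
  set d := K ^ 5 with hd
  obtain ⟨L, hL1, hL⟩ : ∃ L : ℕ, 1 ≤ L ∧
      ((L * (Q * Q) + 1 : ℕ) : ℝ) ^ d * K * θ ^ L < (Q : ℝ) ^ L := by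
    have ht := tendsto_pow_const_mul_const_pow_of_lt_one d (r := θ / Q) (by positivity)
      (by rw [div_lt_one hQ0]; exact hθ)
    have ht2 := ht.const_mul (((Q * Q + 1 : ℕ) : ℝ) ^ d * K)
    rw [mul_zero] at ht2
    obtain ⟨L, hL, hL1⟩ := ((ht2.eventually (gt_mem_nhds one_pos)).and (Filter.eventually_ge_atTop 1)).exists
    refine ⟨L, hL1, ?_⟩
    have hQL : (0 : ℝ) < (Q : ℝ) ^ L := by positivity
    have hle : ((L * (Q * Q) + 1 : ℕ) : ℝ) ≤ ((Q * Q + 1 : ℕ) : ℝ) * L := by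
      have : L * (Q * Q) + 1 ≤ (Q * Q + 1) * L := by nlinarith
      exact_mod_cast this
    calc ((L * (Q * Q) + 1 : ℕ) : ℝ) ^ d * K * θ ^ L
        ≤ (((Q * Q + 1 : ℕ) : ℝ) * L) ^ d * K * θ ^ L := by gcongr
      _ = ((Q * Q + 1 : ℕ) : ℝ) ^ d * K * ((L : ℝ) ^ d * (θ / Q) ^ L) * (Q : ℝ) ^ L := by
        rw [mul_pow, div_pow]; field_simp
      _ < 1 * (Q : ℝ) ^ L := by gcongr
      _ = _ := one_mul _
  refine ⟨Q ^ L, fun A hA hK => ?_⟩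
  by_contra! H
  have hne : A.Nonempty := Finset.card_pos.1 (by omega)
  obtain ⟨N, hN, E, hE, hEc, hEinj, hr⟩ := chain Q A θ hθ0 hθ.le L hA H L le_rfl
  obtain ⟨a0, ha0⟩ := hne
  have hcount : E.card * A.card ≤ ((L * (Q * Q) + 1) • (A - A)).card * rc A N := by
    unfold rc
    rw [← Finset.card_product, ← Finset.card_product]
    refine Finset.card_le_card_of_injOn (fun p => (p.1 + (p.2 - a0), p.2 % (N : ℤ))) ?_ ?_
    · rintro ⟨x, a⟩ hp
      simp only [Finset.coe_product, Set.mem_prod, Finset.mem_coe] at hp ⊢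
      rw [succ_nsmul]
      exact ⟨Finset.add_mem_add (hE hp.1) (Finset.sub_mem_sub hp.2 ha0), Finset.mem_image_of_mem _ hp.2⟩
    · rintro ⟨x, a⟩ hp ⟨x', a'⟩ hp' h
      simp only [Finset.coe_product, Set.mem_prod, Finset.mem_coe, Prod.mk.injEq] at hp hp' h
      have h1 : (N : ℤ) ∣ a' - a := Int.ModEq.dvd (n := N) h.2
      have h2 : x = x' := hEinj x hp.1 x' hp'.1 (by
        rwa [show x - x' = a' - a by linarith [h.1]])
      subst h2
      have : a = a' := by linarith [h.1]
      rw [this]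
  have hgr := growth K A ⟨a0, ha0⟩ hK (L * (Q * Q))
  have hApos : (0 : ℝ) < A.card := by exact_mod_cast Finset.card_pos.2 ⟨a0, ha0⟩
  have h1 : ((Q : ℝ) ^ L) * A.card ≤ (((L * (Q * Q) + 1 : ℕ) : ℝ) ^ d * (K * A.card)) * θ ^ L := by
    calc ((Q : ℝ) ^ L) * A.card = ((E.card * A.card : ℕ) : ℝ) := by rw [hEc]; push_cast; ring
      _ ≤ ((((L * (Q * Q) + 1) • (A - A)).card * rc A N : ℕ) : ℝ) := by exact_mod_cast hcount
      _ = (((L * (Q * Q) + 1) • (A - A)).card : ℝ) * rc A N := by push_cast; ring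
      _ ≤ _ := by
        gcongr
        exact_mod_cast hgr
  have h2 : ((Q : ℝ) ^ L) * A.card ≤ (((L * (Q * Q) + 1 : ℕ) : ℝ) ^ d * K * θ ^ L) * A.card := by
    linarith
  exact absurd (le_of_mul_le_mul_right h2 hApos) (not_le.2 hL)

lemma part2 (K Q : ℕ) [NeZero Q] (δ : ℝ) (A : Finset ℤ) (hne : A.Nonempty)
    (hK : (A - A).card ≤ K * A.card)
    (n : ℕ) (hn : n ≠ 0) (hr : ((Q : ℝ) - δ) * rc A n ≤ rc A (n * Q)) :
    ∃ A' ⊆ A, (1 - δ * K) * (A.card : ℝ) ≤ A'.card ∧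
      (∀ a ∈ A', ∀ c : ZMod Q, ∃ z : ℤ, a + n * z ∈ A' ∧ (z : ZMod Q) = c) := by
  classical
  have hnz : (n : ℤ) ≠ 0 := by exact_mod_cast hn
  have hQ0 : 0 < Q := Nat.pos_of_ne_zero (NeZero.ne Q)
  set A' := A.filter fun a => ∀ c : ZMod Q, ∃ z : ℤ, a + n * z ∈ A ∧ (z : ZMod Q) = c with hA'
  refine ⟨A', Finset.filter_subset _ _, ?_, ?_⟩
  swap
  · intro a ha c
    obtain ⟨haA, hf⟩ := Finset.mem_filter.1 ha
    obtain ⟨z, hz, hzc⟩ := hf c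
    refine ⟨z, Finset.mem_filter.2 ⟨hz, fun c' => ?_⟩, hzc⟩
    obtain ⟨z', hz', hzc'⟩ := hf (c + c')
    refine ⟨z' - z, ?_, ?_⟩
    · rwa [show a + n * z + n * (z' - z) = a + n * z' by ring]
    · push_cast; rw [hzc', hzc]; ring
  set R := A.image (fun a => a % (n : ℤ)) with hR
  have hRc : rc A n = R.card := rfl
  let cl : ℤ → Finset ℤ := fun x => A.filter fun a => a % (n : ℤ) = x
  set Rb := R.filter fun x => ∃ a ∈ cl x, a ∉ A' with hRb
  -- class counting
  have hmem : ∀ x, ∀ a ∈ cl x, ∀ b ∈ cl x, b = a + n * ((b - a) / n) := by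
    intro x a ha b hb
    have : (n : ℤ) ∣ b - a := Int.ModEq.dvd (n := n)
      ((Finset.mem_filter.1 ha).2.trans (Finset.mem_filter.1 hb).2.symm)
    rw [Int.mul_ediv_cancel' this]; ring
  have hq : ∀ x, ∀ a ∈ cl x, rc (cl x) (n * Q) ≤
      ((cl x).image fun b => (((b - a) / n : ℤ) : ZMod Q)).card := by
    intro x a ha
    refine img_le _ _ _ fun b hb b' hb' h => emod_eq_of_dvd ?_
    rw [ZMod.intCast_eq_intCast_iff] at h
    have h2 := h.symm.dvd
    rw [hmem x a ha b hb, hmem x a ha b' hb']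
    rw [add_sub_add_left_eq_sub, ← mul_sub]
    push_cast
    exact mul_dvd_mul_left _ h2
  have hq1 : ∀ x ∈ R, rc (cl x) (n * Q) ≤ Q := by
    intro x hx
    obtain ⟨a, ha, hax⟩ := Finset.mem_image.1 hx
    refine (hq x a (Finset.mem_filter.2 ⟨ha, hax⟩)).trans ((Finset.card_le_univ _).trans ?_)
    rw [ZMod.card]
  have hq2 : ∀ x ∈ Rb, rc (cl x) (n * Q) + 1 ≤ Q := by
    intro x hx
    obtain ⟨hxR, a, ha, haA'⟩ := Finset.mem_filter.1 hx
    have : ∃ c : ZMod Q, ∀ z : ℤ, a + n * z ∈ A → (z : ZMod Q) ≠ c := by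
      by_contra! h
      exact haA' (Finset.mem_filter.2 ⟨(Finset.mem_filter.1 ha).1, h⟩)
    obtain ⟨c, hc⟩ := this
    have hsub : ((cl x).image fun b => (((b - a) / n : ℤ) : ZMod Q)) ⊆ univ.erase c := by
      intro y hy
      obtain ⟨b, hb, rfl⟩ := Finset.mem_image.1 hy
      refine Finset.mem_erase.2 ⟨hc _ ?_, Finset.mem_univ _⟩
      rw [← hmem x a ha b hb]
      exact (Finset.mem_filter.1 hb).1
    have h1 := (hq x a ha).trans (Finset.card_le_card hsub)
    rw [Finset.card_erase_of_mem (Finset.mem_univ _), Finset.card_univ, ZMod.card] at h1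
    omega
  have hq3 : rc A (n * Q) ≤ ∑ x ∈ R, rc (cl x) (n * Q) := by
    unfold rc
    refine le_trans (Finset.card_le_card ?_) Finset.card_biUnion_le
    intro y hy
    obtain ⟨a, ha, rfl⟩ := Finset.mem_image.1 hy
    exact Finset.mem_biUnion.2 ⟨a % n, Finset.mem_image_of_mem _ ha,
      Finset.mem_image_of_mem _ (Finset.mem_filter.2 ⟨ha, rfl⟩)⟩
  have hq4 : rc A (n * Q) + Rb.card ≤ Q * R.card := by
    calc rc A (n * Q) + Rb.card ≤ ∑ x ∈ R, rc (cl x) (n * Q) + Rb.card := by gcongr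
      _ = ∑ x ∈ R, (rc (cl x) (n * Q) + if (∃ a ∈ cl x, a ∉ A') then 1 else 0) := by
        rw [Finset.sum_add_distrib, hRb, Finset.card_filter]
      _ ≤ ∑ x ∈ R, Q := by
        refine Finset.sum_le_sum fun x hx => ?_
        split_ifs with h
        · exact hq2 x (Finset.mem_filter.2 ⟨hx, h⟩)
        · exact hq1 x hx
      _ = _ := by simp [mul_comm]
  have hbad : (Rb.card : ℝ) ≤ δ * R.card := by
    have : (rc A (n * Q) : ℝ) + Rb.card ≤ Q * R.card := by exact_mod_cast hq4
    rw [hRc] at hr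
    linarith
  have hcl : ∀ x ∈ R, R.card * (cl x).card ≤ (A - A).card := by
    intro x hx
    have hrep : ∀ z ∈ R, ∃ a ∈ A, a % (n : ℤ) = z := fun z hz => by simpa [R] using hz
    choose! ρ hρ hρ2 using hrep
    rw [← Finset.card_product]
    refine Finset.card_le_card_of_injOn (fun p => ρ p.1 - p.2) ?_ ?_
    · rintro ⟨z, a⟩ hp
      simp only [Finset.coe_product, Set.mem_prod, Finset.mem_coe] at hp ⊢
      exact Finset.sub_mem_sub (hρ z hp.1) (Finset.mem_filter.1 hp.2).1
    · rintro ⟨z, a⟩ hp ⟨z', a'⟩ hp' h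
      simp only [Finset.coe_product, Set.mem_prod, Finset.mem_coe] at hp hp' h
      have h1 : (n : ℤ) ∣ a - a' := Int.ModEq.dvd (n := n)
        ((Finset.mem_filter.1 hp'.2).2.trans (Finset.mem_filter.1 hp.2).2.symm)
      have h2 : z = z' := by
        rw [← hρ2 z hp.1, ← hρ2 z' hp'.1]
        apply emod_eq_of_dvd
        rwa [show ρ z - ρ z' = a - a' by linarith]
      subst h2
      have : a = a' := by linarith
      rw [this]
  have hsd : A \ A' ⊆ Rb.biUnion cl := by
    intro a ha
    obtain ⟨h1, h2⟩ := Finset.mem_sdiff.1 ha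
    have h3 : a ∈ cl (a % n) := Finset.mem_filter.2 ⟨h1, rfl⟩
    exact Finset.mem_biUnion.2 ⟨a % n, Finset.mem_filter.2 ⟨Finset.mem_image_of_mem _ h1, a, h3, h2⟩, h3⟩
  have h5 : R.card * (A \ A').card ≤ Rb.card * (K * A.card) := by
    calc R.card * (A \ A').card ≤ R.card * ∑ x ∈ Rb, (cl x).card :=
          Nat.mul_le_mul_left _ ((Finset.card_le_card hsd).trans Finset.card_biUnion_le)
      _ = ∑ x ∈ Rb, R.card * (cl x).card := Finset.mul_sum _ _ _
      _ ≤ ∑ x ∈ Rb, K * A.card := Finset.sum_le_sum fun x hx =>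
          (hcl x (Finset.mem_filter.1 hx).1).trans hK
      _ = _ := by simp
  have hRpos : (0 : ℝ) < R.card := by exact_mod_cast Finset.card_pos.2 (hne.image _)
  have h6 : (R.card : ℝ) * (A \ A').card ≤ R.card * (δ * (K * A.card)) := by
    calc (R.card : ℝ) * (A \ A').card ≤ Rb.card * (K * A.card) := by exact_mod_cast h5
      _ ≤ (δ * R.card) * (K * A.card) := by gcongr
      _ = _ := by ring
  have h7 := le_of_mul_le_mul_left h6 hRpos
  have h8 : ((A \ A').card : ℝ) + A'.card = A.card := by
    exact_mod_cast Finset.card_sdiff_add_card_eq_card (Finset.filter_subset _ A)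
  linarith

lemma doubling {m : ℕ} (hm : 2 ≤ m) (u : Fin m → ℤ) (hu : ∀ i, u i ≠ 0) (S : ℕ) (A : Finset ℤ)
    (hne : A.Nonempty) (h : (gsum u fun _ => A).card ≤ S * A.card) :
    (A - A).card ≤ S ^ 2 * A.card := by
  classical
  obtain ⟨a0, ha0⟩ := hne
  set i0 : Fin m := ⟨0, by omega⟩ with hi0
  set i1 : Fin m := ⟨1, by omega⟩ with hi1
  have h01 : i0 ≠ i1 := by simp [hi0, hi1]
  have inj0 : Function.Injective (fun a : ℤ => u i0 * a) := mul_right_injective₀ (hu i0)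
  have inj1 : Function.Injective (fun a : ℤ => (- u i1) * a) :=
    mul_right_injective₀ (neg_ne_zero.2 (hu i1))
  set X := A.image (fun a : ℤ => u i0 * a) with hX
  set Y := A.image (fun a : ℤ => (- u i1) * a) with hY
  have cX : X.card = A.card := card_image_of_injective _ inj0
  have cY : Y.card = A.card := card_image_of_injective _ inj1
  have hXX : (X - X).card = (A - A).card := by
    have : X - X = (A - A).image (fun a : ℤ => u i0 * a) := by
      ext y
      simp only [hX, Finset.mem_sub, Finset.mem_image]
      constructor
      · rintro ⟨_, ⟨a, ha, rfl⟩, _, ⟨b, hb, rfl⟩, rfl⟩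
        exact ⟨a - b, ⟨a, ha, b, hb, rfl⟩, by ring⟩
      · rintro ⟨_, ⟨a, ha, b, hb, rfl⟩, rfl⟩
        exact ⟨_, ⟨a, ha, rfl⟩, _, ⟨b, hb, rfl⟩, by ring⟩
    rw [this, card_image_of_injective _ inj0]
  have hXY : (X - Y).card ≤ S * A.card := by
    refine le_trans ?_ h
    refine Finset.card_le_card_of_injOn
      (fun y => y + ∑ i ∈ (univ.erase i0).erase i1, u i * a0) ?_ ?_
    · intro y hy
      simp only [Finset.mem_coe, hX, hY, Finset.mem_sub, Finset.mem_image] at hy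
      obtain ⟨_, ⟨a, ha, rfl⟩, _, ⟨b, hb, rfl⟩, rfl⟩ := hy
      rw [Finset.mem_coe, mem_gsum]
      refine ⟨fun i => if i = i0 then a else if i = i1 then b else a0, ?_, ?_⟩
      · intro i
        dsimp only
        split_ifs <;> assumption
      · rw [← Finset.add_sum_erase _ _ (mem_univ i0),
          ← Finset.add_sum_erase (univ.erase i0) _ (mem_erase.2 ⟨h01.symm, mem_univ i1⟩)]
        have : ∑ i ∈ (univ.erase i0).erase i1,
            u i * (if i = i0 then a else if i = i1 then b else a0)
            = ∑ i ∈ (univ.erase i0).erase i1, u i * a0 := by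
          refine Finset.sum_congr rfl fun i hi => ?_
          simp only [mem_erase] at hi
          rw [if_neg hi.2.1, if_neg hi.1]
        rw [this]
        simp only [if_true, if_neg h01.symm]
        ring
    · intro a _ b _ hab
      simpa using hab
  have := Finset.ruzsa_triangle_inequality_sub_sub_sub X Y X
  rw [hXX, cY] at this
  have hpos : 0 < A.card := card_pos.2 ⟨a0, ha0⟩
  refine Nat.le_of_mul_le_mul_right (this.trans ((Nat.mul_le_mul hXY hXY).trans ?_)) hpos
  apply le_of_eq
  ring

lemma gsum_mono {m : ℕ} (u : Fin m → ℤ) {A' A : Finset ℤ} (h : A' ⊆ A) :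
    (gsum u fun _ => A') ⊆ (gsum u fun _ => A) := by
  intro y hy
  rw [mem_gsum] at hy ⊢
  obtain ⟨t, ht, rfl⟩ := hy
  exact ⟨t, fun i => h (ht i), rfl⟩

lemma lower {m : ℕ} (hm : 2 ≤ m) (u : Fin m → ℤ) (hu : ∀ i, u i ≠ 0)
    (hgcd : Finset.univ.gcd u = 1) (ε : ℝ) (hε : 0 < ε) :
    ∃ k0 : ℕ, ∀ A : Finset ℤ, k0 ≤ A.card →
      (((∑ i, (u i).natAbs : ℕ) : ℝ) - ε) * A.card ≤ ((gsum u fun _ => A).card : ℝ) := by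
  classical
  set S : ℕ := ∑ i, (u i).natAbs with hS
  set Q : ℕ := ∏ i, (u i).natAbs with hQ
  have hQ0 : Q ≠ 0 := Finset.prod_ne_zero_iff.2 fun i _ => Int.natAbs_ne_zero.2 (hu i)
  haveI : NeZero Q := ⟨hQ0⟩
  have hdvd : ∀ i, (u i).natAbs ∣ Q := fun i => Finset.dvd_prod_of_mem _ (mem_univ i)
  have hQ1 : (1 : ℝ) ≤ Q := by exact_mod_cast Nat.one_le_iff_ne_zero.2 hQ0
  set K : ℕ := S ^ 2 with hK
  set δ : ℝ := min 1 (ε / 2 / (S * K + 1)) with hδ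
  have hSK : (0 : ℝ) < S * K + 1 := by positivity
  have hδ0 : 0 < δ := lt_min one_pos (by positivity)
  have hδ1 : δ ≤ 1 := min_le_left _ _
  have hδ2 : S * K * δ ≤ ε / 2 := by
    have h1 : δ ≤ ε / 2 / (S * K + 1) := min_le_right _ _
    rw [le_div_iff₀ hSK] at h1
    nlinarith
  obtain ⟨B, hB⟩ := part1 K Q ((Q : ℝ) - δ) (by linarith) (by linarith)
  obtain ⟨k1, hk1⟩ := exists_nat_gt ((B * (Q * m) : ℝ) / (ε / 2))
  refine ⟨max (B + 1) k1, fun A hA => ?_⟩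
  have hA1 : B < A.card := le_trans (le_max_left _ _) hA
  have hA2 : k1 ≤ A.card := le_trans (le_max_right _ _) hA
  have hne : A.Nonempty := card_pos.1 (by omega)
  by_cases hbig : (gsum u fun _ => A).card ≤ S * A.card
  swap
  · have h1 : (S * A.card : ℝ) ≤ ((gsum u fun _ => A).card : ℝ) := by
      exact_mod_cast (not_le.1 hbig).le
    have h2 : 0 ≤ ε * A.card := by positivity
    linarith
  have hd := doubling hm u hu S A hne hbig
  obtain ⟨n, hn, hrB, hr⟩ := hB A hA1 hd
  obtain ⟨A', hsub, hcard, hfull⟩ := part2 K Q δ A hne hd n hn hr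
  have hc := count_full u hu hgcd Q hdvd n hn A' hfull
  have h3 : (gsum u fun _ => A').card ≤ (gsum u fun _ => A).card := card_le_card (gsum_mono u hsub)
  have h4 : rc A' n ≤ B := (rc_mono hsub n).trans hrB
  have h5 : S * A'.card ≤ (gsum u fun _ => A).card + B * (Q * m) :=
    hc.trans (Nat.add_le_add h3 (Nat.mul_le_mul_right _ h4))
  have h6 : (S * A'.card : ℝ) ≤ ((gsum u fun _ => A).card : ℝ) + B * (Q * m) := by exact_mod_cast h5
  have h7 : (B * (Q * m) : ℝ) ≤ ε / 2 * A.card := by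
    rw [div_lt_iff₀ (by positivity)] at hk1
    have : (k1 : ℝ) ≤ A.card := by exact_mod_cast hA2
    nlinarith
  have h8 : (S : ℝ) * ((1 - δ * K) * A.card) ≤ S * A'.card :=
    mul_le_mul_of_nonneg_left hcard (by positivity)
  have h9 : S * K * δ * A.card ≤ ε / 2 * A.card :=
    mul_le_mul_of_nonneg_right hδ2 (by positivity)
  nlinarith

lemma upper {m : ℕ} (u : Fin m → ℤ) (hm : 2 ≤ m) (hu : ∀ i, u i ≠ 0) (k : ℕ) (hk : 0 < k) :
    (gsum u fun _ => Finset.Ico (0 : ℤ) k).card ≤ (∑ i, (u i).natAbs) * k := by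
  set L : ℤ := ∑ i, min (u i) 0 * (k - 1) with hL
  set U : ℤ := ∑ i, max (u i) 0 * (k - 1) with hU
  have hk' : (1 : ℤ) ≤ k := by exact_mod_cast hk
  have hsub : (gsum u fun _ => Finset.Ico (0 : ℤ) k) ⊆ Finset.Icc L U := by
    intro y hy
    rw [mem_gsum] at hy
    obtain ⟨t, ht, rfl⟩ := hy
    simp only [Finset.mem_Ico] at ht
    rw [Finset.mem_Icc]
    constructor
    · refine Finset.sum_le_sum fun i _ => ?_
      have := ht i
      rcases le_total (u i) 0 with h | h
      · rw [min_eq_left h]; nlinarith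
      · rw [min_eq_right h]; nlinarith
    · refine Finset.sum_le_sum fun i _ => ?_
      have := ht i
      rcases le_total (u i) 0 with h | h
      · rw [max_eq_right h]; nlinarith
      · rw [max_eq_left h]; nlinarith
  have hUL : U - L = ((∑ i, (u i).natAbs : ℕ) : ℤ) * (k - 1) := by
    rw [hU, hL, ← Finset.sum_sub_distrib, Nat.cast_sum, Finset.sum_mul]
    refine Finset.sum_congr rfl fun i _ => ?_
    rw [← sub_mul, max_sub_min_eq_abs, zero_sub, abs_neg, Int.natCast_natAbs]
  have hS1 : 1 ≤ ∑ i, (u i).natAbs := by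
    have i0 : Fin m := ⟨0, by omega⟩
    calc 1 ≤ (u i0).natAbs := Nat.one_le_iff_ne_zero.2 (Int.natAbs_ne_zero.2 (hu i0))
      _ ≤ _ := Finset.single_le_sum (f := fun i => (u i).natAbs) (fun _ _ => Nat.zero_le _)
        (mem_univ i0)
  have := card_le_card hsub
  rw [Int.card_Icc] at this
  refine this.trans ?_
  rw [Int.toNat_le]
  push_cast at hUL ⊢
  have hS1' : (1 : ℤ) ≤ ∑ i, |u i| := by
    have h : ((1 : ℕ) : ℤ) ≤ ((∑ i, (u i).natAbs : ℕ) : ℤ) := Int.ofNat_le.2 hS1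
    push_cast at h
    exact h
  linarith

end Helpers

/-- Bukh: for a linear form `f` with nonzero integer coefficients and `gcd(u₁,…,u_m)=1`,
`N_f(k) = (|u₁|+⋯+|u_m|)k − o(k)`, i.e. `N_f(k)/k → |u₁|+⋯+|u_m|`. -/
theorem stmt6 (m : ℕ) (hm : 2 ≤ m) (u : Fin m → ℤ) (hu : ∀ i, u i ≠ 0)
    (hgcd : Finset.univ.gcd u = 1) :
    Tendsto (fun k : ℕ =>
        ((sInf {n : ℕ | ∃ A : Finset ℤ, A.card = k ∧ (formImage u A).card = n} : ℕ) : ℝ) / (k : ℝ))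
      atTop (nhds (∑ i, (|u i| : ℝ))) := by
  have hsum : (∑ i, (|u i| : ℝ)) = ((∑ i, (u i).natAbs : ℕ) : ℝ) := by
    rw [Nat.cast_sum]
    refine Finset.sum_congr rfl fun i _ => ?_
    rw [Nat.cast_natAbs, Int.cast_abs]
  rw [hsum, Metric.tendsto_atTop]
  intro ε hε
  obtain ⟨k0, hk0⟩ := lower hm u hu hgcd (ε / 2) (by linarith)
  refine ⟨max k0 1, fun k hk => ?_⟩
  have hk1 : k0 ≤ k := le_trans (le_max_left _ _) hk
  have hk2 : 0 < k := le_trans (le_max_right _ _) hk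
  have hkR : (0 : ℝ) < k := by exact_mod_cast hk2
  have hmem : (gsum u fun _ => Finset.Ico (0 : ℤ) k).card ∈
      {n : ℕ | ∃ A : Finset ℤ, A.card = k ∧ (formImage u A).card = n} :=
    ⟨Finset.Ico (0 : ℤ) k, by simp, rfl⟩
  have hup := (Nat.sInf_le hmem).trans (upper u hm hu k hk2)
  obtain ⟨A, hAk, hA⟩ := Nat.sInf_mem ⟨_, hmem⟩
  have hlow := hk0 A (by omega)
  have hA' : (gsum u fun _ => A).card =
    sInf {n : ℕ | ∃ A : Finset ℤ, A.card = k ∧ (formImage u A).card = n} := hA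
  rw [hA', hAk] at hlow
  generalize sInf {n : ℕ | ∃ A : Finset ℤ, A.card = k ∧ (formImage u A).card = n} = N at hup hlow ⊢
  have hup' : (N : ℝ) ≤ ((∑ i, (u i).natAbs : ℕ) : ℝ) * k := by exact_mod_cast hup
  generalize ((∑ i, (u i).natAbs : ℕ) : ℝ) = S at hup' hlow ⊢
  have e1 : (N : ℝ) / k ≤ S := by rwa [div_le_iff₀ hkR]
  have e2 : S - ε / 2 ≤ (N : ℝ) / k := by rwa [le_div_iff₀ hkR]
  rw [Real.dist_eq, abs_lt]
  constructor <;> linarith
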